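/- Reverse Poincaré inequality for biharmonic functions (Lemma 3.4, Euclidean case K = 0): For every integer n ≥ 1 and every ε ∈ (0,1) there is a constant c = c(n,ε) > 0 with the following property. Let p ∈ ℝⁿ, r > 0, and let u : ℝⁿ → ℝ be smooth with ΔΔu = 0 on ℝⁿ. Then r⁴·(∫_{B_{εr}(p)} |∇²u|² + r²·∫_{B_{εr}(p)} |∇Δu|²) ≤ c·(∫_{B_r(p)} u² + r²·∫_{B_r(p)} |∇u|²). -/

import Mathlib

open Set Metric MeasureTheory

noncomputable section

/-- The Euclidean Laplacian of `f : ℝⁿ → ℝ`. -/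
def lapE (n : ℕ) (f : EuclideanSpace ℝ (Fin n) → ℝ) (x : EuclideanSpace ℝ (Fin n)) : ℝ :=
  ∑ i : Fin n, fderiv ℝ (fun y => fderiv ℝ f y (EuclideanSpace.single i 1)) x
    (EuclideanSpace.single i 1)

/-- The squared Hilbert–Schmidt norm of the Hessian of `f : ℝⁿ → ℝ`. -/
def hessNormSq (n : ℕ) (f : EuclideanSpace ℝ (Fin n) → ℝ) (x : EuclideanSpace ℝ (Fin n)) : ℝ :=
  ∑ i : Fin n, ∑ j : Fin n,
    (fderiv ℝ (fun y => fderiv ℝ f y (EuclideanSpace.single j 1)) x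
      (EuclideanSpace.single i 1)) ^ 2

/-- The spatial Laplacian of `u : ℝⁿ × ℝ → ℝ`. -/
def slap (n : ℕ) (u : EuclideanSpace ℝ (Fin n) × ℝ → ℝ) :
    EuclideanSpace ℝ (Fin n) × ℝ → ℝ :=
  fun z => lapE n (fun y => u (y, z.2)) z.1

/-- The time derivative of `u : ℝⁿ × ℝ → ℝ`. -/
def tderiv (n : ℕ) (u : EuclideanSpace ℝ (Fin n) × ℝ → ℝ) :
    EuclideanSpace ℝ (Fin n) × ℝ → ℝ :=
  fun z => deriv (fun s => u (z.1, s)) z.2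

/-- The spatial gradient of `u : ℝⁿ × ℝ → ℝ`. -/
def sgrad (n : ℕ) (u : EuclideanSpace ℝ (Fin n) × ℝ → ℝ) :
    EuclideanSpace ℝ (Fin n) × ℝ → EuclideanSpace ℝ (Fin n) :=
  fun z => gradient (fun y => u (y, z.2)) z.1

/-- The squared Hilbert–Schmidt norm of the spatial Hessian of `u : ℝⁿ × ℝ → ℝ`. -/
def shessNormSq (n : ℕ) (u : EuclideanSpace ℝ (Fin n) × ℝ → ℝ) :
    EuclideanSpace ℝ (Fin n) × ℝ → ℝ :=
  fun z => hessNormSq n (fun y => u (y, z.2)) z.1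

/-- The heat ball `Q_r(p) = B_r(p) × [-r⁴, 0]`. -/
def heatBall (n : ℕ) (p : EuclideanSpace ℝ (Fin n)) (r : ℝ) :
    Set (EuclideanSpace ℝ (Fin n) × ℝ) :=
  Metric.ball p r ×ˢ Set.Icc (-(r ^ 4)) 0

/-- `u` solves the biharmonic heat equation `∂ₜ u + ΔΔ u = 0` on `ℝⁿ × [-r⁴, 0]`. -/
def BicaloricOn (n : ℕ) (u : EuclideanSpace ℝ (Fin n) × ℝ → ℝ) (r : ℝ) : Prop :=
  ∀ (x : EuclideanSpace ℝ (Fin n)), ∀ t ∈ Set.Icc (-(r ^ 4)) (0 : ℝ),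
    tderiv n u (x, t) + slap n (slap n u) (x, t) = 0

/-- `u ∈ 𝒫_{d,d'}(ℝⁿ)`: a smooth ancient solution of the biharmonic heat equation with
`sup_{Q_R(p)} |u| ≤ C (1+R)^d` and `sup_{Q_R(p)} |∇u| ≤ C' (1+R)^{d'}`. -/
def PolyCaloric (n : ℕ) (d d' : ℝ) (u : EuclideanSpace ℝ (Fin n) × ℝ → ℝ) : Prop :=
  ContDiff ℝ (⊤ : ℕ∞) u ∧
  (∀ (x : EuclideanSpace ℝ (Fin n)), ∀ t ≤ (0 : ℝ),
    tderiv n u (x, t) + slap n (slap n u) (x, t) = 0) ∧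
  (∃ C : ℝ, 0 < C ∧ ∀ (p : EuclideanSpace ℝ (Fin n)) (R : ℝ), 0 < R →
    ∀ z ∈ heatBall n p R, |u z| ≤ C * (1 + R) ^ d) ∧
  (∃ C' : ℝ, 0 < C' ∧ ∀ (p : EuclideanSpace ℝ (Fin n)) (R : ℝ), 0 < R →
    ∀ z ∈ heatBall n p R, ‖sgrad n u z‖ ≤ C' * (1 + R) ^ d')

/-- `u ∈ ℋ_{d,d'}(ℝⁿ)`: a smooth biharmonic function with `sup_{B_R(p)} |u| ≤ C (1+R)^d`
and `sup_{B_R(p)} |∇u| ≤ C' (1+R)^{d'}`. -/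
def PolyBiharmonic (n : ℕ) (d d' : ℝ) (u : EuclideanSpace ℝ (Fin n) → ℝ) : Prop :=
  ContDiff ℝ (⊤ : ℕ∞) u ∧
  (∀ x, lapE n (lapE n u) x = 0) ∧
  (∃ C : ℝ, 0 < C ∧ ∀ (p : EuclideanSpace ℝ (Fin n)) (R : ℝ), 0 < R →
    ∀ x ∈ Metric.ball p R, |u x| ≤ C * (1 + R) ^ d) ∧
  (∃ C' : ℝ, 0 < C' ∧ ∀ (p : EuclideanSpace ℝ (Fin n)) (R : ℝ), 0 < R →
    ∀ x ∈ Metric.ball p R, ‖gradient u x‖ ≤ C' * (1 + R) ^ d')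

/-- The set `𝒫_{d,d'}(ℝⁿ)`. -/
def Pset (n : ℕ) (d d' : ℝ) : Set (EuclideanSpace ℝ (Fin n) × ℝ → ℝ) :=
  {u | PolyCaloric n d d' u}

/-- The set `ℋ_{d,d'}(ℝⁿ)`. -/
def Hset (n : ℕ) (d d' : ℝ) : Set (EuclideanSpace ℝ (Fin n) → ℝ) :=
  {u | PolyBiharmonic n d d' u}

/-- `i`-th partial derivative. -/
def Dd (n : ℕ) (i : Fin n) (f : EuclideanSpace ℝ (Fin n) → ℝ) (x : EuclideanSpace ℝ (Fin n)) : ℝ :=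
  fderiv ℝ f x (EuclideanSpace.single i 1)

/-- squared gradient norm in coordinates -/
def gsq (n : ℕ) (f : EuclideanSpace ℝ (Fin n) → ℝ) (x : EuclideanSpace ℝ (Fin n)) : ℝ :=
  ∑ i : Fin n, (Dd n i f x) ^ 2

lemma lapE_eq (n : ℕ) (f : EuclideanSpace ℝ (Fin n) → ℝ) (x) :
    lapE n f x = ∑ i : Fin n, Dd n i (Dd n i f) x := rfl

lemma hess_eq (n : ℕ) (f : EuclideanSpace ℝ (Fin n) → ℝ) (x) :
    hessNormSq n f x = ∑ j : Fin n, gsq n (Dd n j f) x := by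
  unfold hessNormSq gsq
  rw [Finset.sum_comm]
  rfl

lemma gsq_nonneg (n : ℕ) (f : EuclideanSpace ℝ (Fin n) → ℝ) (x) : 0 ≤ gsq n f x :=
  Finset.sum_nonneg fun _ _ => sq_nonneg _

lemma gradient_sq (n : ℕ) (f : EuclideanSpace ℝ (Fin n) → ℝ) (x) :
    ‖gradient f x‖ ^ 2 = gsq n f x := by
  rw [EuclideanSpace.norm_sq_eq]
  unfold gsq Dd
  refine Finset.sum_congr rfl fun i _ => ?_
  have : fderiv ℝ f x (EuclideanSpace.single i 1) = gradient f x i := by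
    rw [← toDual_gradient]
    rw [InnerProductSpace.toDual_apply_apply, EuclideanSpace.inner_single_right]
    simp
  rw [this, Real.norm_eq_abs, sq_abs]

lemma Dd_smooth {n : ℕ} (i : Fin n) {f : EuclideanSpace ℝ (Fin n) → ℝ}
    (hf : ContDiff ℝ (⊤ : ℕ∞) f) : ContDiff ℝ (⊤ : ℕ∞) (Dd n i f) := by
  unfold Dd
  exact (hf.fderiv_right (m := ((⊤ : ℕ∞) : WithTop ℕ∞)) (by norm_cast)).clm_apply contDiff_const

lemma lapE_smooth {n : ℕ} {f : EuclideanSpace ℝ (Fin n) → ℝ}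
    (hf : ContDiff ℝ (⊤ : ℕ∞) f) : ContDiff ℝ (⊤ : ℕ∞) (lapE n f) := by
  have : lapE n f = fun x => ∑ i : Fin n, Dd n i (Dd n i f) x := rfl
  rw [this]
  exact ContDiff.sum fun i _ => Dd_smooth i (Dd_smooth i hf)

lemma gsq_cont {n : ℕ} {f : EuclideanSpace ℝ (Fin n) → ℝ}
    (hf : ContDiff ℝ (⊤ : ℕ∞) f) : Continuous (gsq n f) := by
  unfold gsq
  exact continuous_finsetSum _ fun i _ => ((Dd_smooth i hf).continuous).pow 2

lemma smooth_diff {n : ℕ} {f : EuclideanSpace ℝ (Fin n) → ℝ}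
    (hf : ContDiff ℝ (⊤ : ℕ∞) f) (x) : DifferentiableAt ℝ f x :=
  (hf.differentiable (by simp)) x

lemma Dd_comm {n : ℕ} (i j : Fin n) {f : EuclideanSpace ℝ (Fin n) → ℝ}
    (hf : ContDiff ℝ (⊤ : ℕ∞) f) (x) : Dd n i (Dd n j f) x = Dd n j (Dd n i f) x := by
  have hd : DifferentiableAt ℝ (fderiv ℝ f) x :=
    ((hf.fderiv_right (m := ((⊤ : ℕ∞) : WithTop ℕ∞)) (by norm_cast)).differentiable (by simp)) x
  have key : ∀ i j : Fin n, Dd n i (Dd n j f) x =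
      fderiv ℝ (fderiv ℝ f) x (EuclideanSpace.single i 1) (EuclideanSpace.single j 1) := by
    intro i j
    unfold Dd
    rw [fderiv_clm_apply hd (differentiableAt_const _)]
    simp
  rw [key, key]
  have hs : IsSymmSndFDerivAt ℝ f x :=
    hf.contDiffAt.isSymmSndFDerivAt (by
      rw [minSmoothness_of_isRCLikeNormedField]
      exact WithTop.coe_le_coe.2 (le_top : (2 : ℕ∞) ≤ ⊤))
  exact hs _ _

lemma lapE_Dd {n : ℕ} (j : Fin n) {f : EuclideanSpace ℝ (Fin n) → ℝ}
    (hf : ContDiff ℝ (⊤ : ℕ∞) f) (x) : lapE n (Dd n j f) x = Dd n j (lapE n f) x := by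
  have h1 : Dd n j (lapE n f) x = ∑ i : Fin n, Dd n j (Dd n i (Dd n i f)) x := by
    have : lapE n f = fun x => ∑ i : Fin n, Dd n i (Dd n i f) x := rfl
    rw [this]
    conv_lhs => unfold Dd
    rw [fderiv_fun_sum]
    · simp only [sum_apply]; rfl
    · intro i _
      exact smooth_diff (Dd_smooth i (Dd_smooth i hf)) x
  rw [h1, lapE_eq]
  refine Finset.sum_congr rfl fun i _ => ?_
  rw [Dd_comm j i (Dd_smooth i hf)]
  congr 1
  funext y
  exact Dd_comm i j hf y

lemma int_of {n : ℕ} {φ g : EuclideanSpace ℝ (Fin n) → ℝ} (hc : HasCompactSupport φ)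
    (hg : Continuous g) (h : ∀ x, φ x = 0 → g x = 0) : Integrable g := by
  refine hg.integrable_of_hasCompactSupport (hc.mono ?_)
  intro x hx hx'
  exact hx (h x hx')

lemma Dd_prod {n : ℕ} (i : Fin n) (k : ℕ) {φ w f : EuclideanSpace ℝ (Fin n) → ℝ}
    (hφ : ContDiff ℝ (⊤ : ℕ∞) φ) (hw : ContDiff ℝ (⊤ : ℕ∞) w) (hf : ContDiff ℝ (⊤ : ℕ∞) f) (x) :
    Dd n i (fun x => φ x ^ (k + 1) * w x * f x) x =
      (k + 1 : ℝ) * φ x ^ k * Dd n i φ x * w x * f x + φ x ^ (k + 1) * Dd n i w x * f x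
        + φ x ^ (k + 1) * w x * Dd n i f x := by
  have h1 := (smooth_diff hφ x).hasFDerivAt
  have h2 := (smooth_diff hw x).hasFDerivAt
  have h3 := (smooth_diff hf x).hasFDerivAt
  have := (((h1.pow (k + 1)).mul h2).mul h3).fderiv
  unfold Dd
  have e : (fun x => φ x ^ (k + 1) * w x * f x) =
      (fun x => φ x ^ (k + 1)) * w * f := rfl
  rw [e, this]
  simp
  ring

lemma div_zero' {n : ℕ} (i : Fin n) {X : EuclideanSpace ℝ (Fin n) → ℝ}
    (hX : ContDiff ℝ (⊤ : ℕ∞) X) (hc : HasCompactSupport X) : ∫ x, Dd n i X x = 0 := by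
  have h := integral_mul_fderiv_eq_neg_fderiv_mul_of_integrable (𝕜 := ℝ)
    (μ := (volume : Measure (EuclideanSpace ℝ (Fin n))))
    (f := fun _ => (1 : ℝ)) (g := X) (v := EuclideanSpace.single i 1) ?_ ?_ ?_ ?_ ?_
  · simpa [Dd] using h
  · simp
  · simp only [one_mul]
    exact (Dd_smooth i hX).continuous.integrable_of_hasCompactSupport
      (hc.fderiv_apply (𝕜 := ℝ) _)
  · simp only [one_mul]
    exact hX.continuous.integrable_of_hasCompactSupport hc
  · intro x _; exact differentiableAt_const _
  · intro x _; exact smooth_diff hX x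

/-- The divergence of `φ^(k+1) w ∇f`. -/
def dv (n k : ℕ) (φ w f : EuclideanSpace ℝ (Fin n) → ℝ) (x : EuclideanSpace ℝ (Fin n)) : ℝ :=
  ∑ i : Fin n, ((k + 1 : ℝ) * φ x ^ k * Dd n i φ x * w x * Dd n i f x
    + φ x ^ (k + 1) * Dd n i w x * Dd n i f x + φ x ^ (k + 1) * w x * Dd n i (Dd n i f) x)

lemma dv_int {n : ℕ} (k : ℕ) {φ w f : EuclideanSpace ℝ (Fin n) → ℝ}
    (hφ : ContDiff ℝ (⊤ : ℕ∞) φ) (hc : HasCompactSupport φ)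
    (hw : ContDiff ℝ (⊤ : ℕ∞) w) (hf : ContDiff ℝ (⊤ : ℕ∞) f) :
    Integrable (dv n k φ w f) ∧ ∫ x, dv n k φ w f x = 0 := by
  have hX : ∀ i, ContDiff ℝ (⊤ : ℕ∞) (fun x => φ x ^ (k + 1) * w x * Dd n i f x) := fun i =>
    ((hφ.pow _).mul hw).mul (Dd_smooth i hf)
  have hXc : ∀ i, HasCompactSupport (fun x => φ x ^ (k + 1) * w x * Dd n i f x) := fun i =>
    hc.mono fun x hx hx' => hx (by simp [hx'])
  have e : dv n k φ w f = fun x => ∑ i : Fin n,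
      Dd n i (fun x => φ x ^ (k + 1) * w x * Dd n i f x) x := by
    funext x
    unfold dv
    refine Finset.sum_congr rfl fun i _ => ?_
    rw [Dd_prod i k hφ hw (Dd_smooth i hf)]
  have hI : ∀ i, Integrable (Dd n i (fun x => φ x ^ (k + 1) * w x * Dd n i f x)) := fun i =>
    (Dd_smooth i (hX i)).continuous.integrable_of_hasCompactSupport
      ((hXc i).fderiv_apply (𝕜 := ℝ) _)
  rw [e]
  refine ⟨integrable_finsetSum _ fun i _ => hI i, ?_⟩
  rw [integral_finsetSum _ fun i _ => hI i]
  exact Finset.sum_eq_zero fun i _ => div_zero' i (hX i) (hXc i)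

lemma cacc_pt {n : ℕ} {φ w : EuclideanSpace ℝ (Fin n) → ℝ} {M : ℝ} (x)
    (hM : gsq n φ x ≤ M ^ 2) :
    φ x ^ 6 * gsq n w x ≤ 2 * dv n 5 φ w w x +
      (-2 * (φ x ^ 6 * w x * lapE n w x) + 36 * M ^ 2 * (φ x ^ 4 * w x ^ 2)) := by
  have h1 : φ x ^ 6 * gsq n w x ≤ 2 * dv n 5 φ w w x +
      (-2 * (φ x ^ 6 * w x * lapE n w x) + 36 * (φ x ^ 4 * w x ^ 2) * gsq n φ x) := by
    unfold gsq dv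
    rw [lapE_eq]
    simp only [Finset.mul_sum]
    rw [← Finset.sum_add_distrib, ← Finset.sum_add_distrib]
    refine Finset.sum_le_sum fun i _ => ?_
    have := sq_nonneg (φ x ^ 3 * Dd n i w x + 6 * φ x ^ 2 * Dd n i φ x * w x)
    push_cast
    nlinarith [this]
  have h2 : 36 * (φ x ^ 4 * w x ^ 2) * gsq n φ x ≤ 36 * (φ x ^ 4 * w x ^ 2) * M ^ 2 := by
    gcongr
  linarith

lemma cacc {n : ℕ} {φ w : EuclideanSpace ℝ (Fin n) → ℝ} {M : ℝ}
    (hφ : ContDiff ℝ (⊤ : ℕ∞) φ) (hc : HasCompactSupport φ)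
    (hw : ContDiff ℝ (⊤ : ℕ∞) w) (hM : ∀ x, gsq n φ x ≤ M ^ 2) :
    ∫ x, φ x ^ 6 * gsq n w x ≤
      -2 * (∫ x, φ x ^ 6 * w x * lapE n w x) + 36 * M ^ 2 * ∫ x, φ x ^ 4 * w x ^ 2 := by
  have cφ := hφ.continuous
  have cw := hw.continuous
  have cg := gsq_cont hw
  have cl := (lapE_smooth hw).continuous
  have i1 : Integrable (fun x => φ x ^ 6 * gsq n w x) :=
    int_of hc (by fun_prop) (by intro x hx; simp [hx])
  have i2 : Integrable (fun x => φ x ^ 6 * w x * lapE n w x) :=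
    int_of hc (by fun_prop) (by intro x hx; simp [hx])
  have i3 : Integrable (fun x => φ x ^ 4 * w x ^ 2) :=
    int_of hc (by fun_prop) (by intro x hx; simp [hx])
  obtain ⟨i4, z4⟩ := dv_int 5 hφ hc hw hw
  have := integral_mono i1 ((i4.const_mul 2).add ((i2.const_mul (-2)).add
    (i3.const_mul (36 * M ^ 2)))) (fun x => cacc_pt x (hM x))
  rw [integral_add' (i4.const_mul 2) ((i2.const_mul (-2)).add (i3.const_mul (36 * M ^ 2))),
    integral_add' (i2.const_mul (-2)) (i3.const_mul (36 * M ^ 2)), integral_const_mul,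
    integral_const_mul, integral_const_mul, z4] at this
  linarith

lemma lap_pt {n : ℕ} {φ u : EuclideanSpace ℝ (Fin n) → ℝ} {M m : ℝ} (hm : m * M = 1) (x)
    (hM : gsq n φ x ≤ M ^ 2) :
    φ x ^ 4 * lapE n u x ^ 2 ≤ dv n 3 φ (lapE n u) u x +
      (m ^ 2 / 144 * (φ x ^ 6 * gsq n (lapE n u) x) + (52 * M ^ 2 * (φ x ^ 2 * gsq n u x)
        + 1 / 4 * (φ x ^ 4 * lapE n u x ^ 2))) := by
  have h1 : φ x ^ 4 * lapE n u x * (∑ i : Fin n, Dd n i (Dd n i u) x)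
      ≤ dv n 3 φ (lapE n u) u x +
      (m ^ 2 / 144 * (φ x ^ 6 * gsq n (lapE n u) x) + (52 * M ^ 2 * (φ x ^ 2 * gsq n u x)
        + 1 / 4 * (φ x ^ 4 * lapE n u x ^ 2) * m ^ 2 * gsq n φ x)) := by
    unfold gsq dv
    simp only [Finset.mul_sum]
    rw [← Finset.sum_add_distrib, ← Finset.sum_add_distrib, ← Finset.sum_add_distrib]
    refine Finset.sum_le_sum fun i _ => ?_
    set a := φ x
    set d := Dd n i φ x
    set v := lapE n u x
    set h := Dd n i (lapE n u) x
    set g := Dd n i u x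
    have s1 := sq_nonneg (a ^ 3 * h * m / 12 + 6 * M * a * g)
    have s2 := sq_nonneg (a ^ 2 * v * d * m / 2 + 4 * M * a * g)
    have e1 : (a ^ 3 * h * m / 12 + 6 * M * a * g) ^ 2 =
      m ^ 2 / 144 * (a ^ 6 * h ^ 2) + a ^ 4 * h * g * (m * M) + 36 * M ^ 2 * (a ^ 2 * g ^ 2) := by
      ring
    have e2 : (a ^ 2 * v * d * m / 2 + 4 * M * a * g) ^ 2 =
      1 / 4 * (a ^ 4 * v ^ 2) * m ^ 2 * d ^ 2 + 4 * a ^ 3 * v * d * g * (m * M)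
        + 16 * M ^ 2 * (a ^ 2 * g ^ 2) := by
      ring
    rw [hm] at e1 e2
    rw [e1] at s1
    rw [e2] at s2
    push_cast
    linarith
  rw [← lapE_eq] at h1
  have h2 : 1 / 4 * (φ x ^ 4 * lapE n u x ^ 2) * m ^ 2 * gsq n φ x ≤
      1 / 4 * (φ x ^ 4 * lapE n u x ^ 2) * m ^ 2 * M ^ 2 := by
    gcongr
  have h3 : 1 / 4 * (φ x ^ 4 * lapE n u x ^ 2) * m ^ 2 * M ^ 2 =
      1 / 4 * (φ x ^ 4 * lapE n u x ^ 2) := by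
    rw [mul_assoc _ (m ^ 2), ← mul_pow, hm]; ring
  nlinarith [h1, h2, h3]

lemma lap_bound {n : ℕ} {φ u : EuclideanSpace ℝ (Fin n) → ℝ} {M : ℝ} (hM0 : 0 < M)
    (hφ : ContDiff ℝ (⊤ : ℕ∞) φ) (hc : HasCompactSupport φ)
    (hu : ContDiff ℝ (⊤ : ℕ∞) u) (hM : ∀ x, gsq n φ x ≤ M ^ 2)
    (hb : ∀ x, lapE n (lapE n u) x = 0) :
    ∫ x, φ x ^ 6 * gsq n (lapE n u) x ≤ 3744 * M ^ 4 * ∫ x, φ x ^ 2 * gsq n u x := by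
  have hv := lapE_smooth hu
  have cφ := hφ.continuous
  have cv := hv.continuous
  have cg := gsq_cont hv
  have cu := gsq_cont hu
  have i1 : Integrable (fun x => φ x ^ 6 * gsq n (lapE n u) x) :=
    int_of hc (by fun_prop) (by intro x hx; simp [hx])
  have i2 : Integrable (fun x => φ x ^ 2 * gsq n u x) :=
    int_of hc (by fun_prop) (by intro x hx; simp [hx])
  have i3 : Integrable (fun x => φ x ^ 4 * lapE n u x ^ 2) :=
    int_of hc (by fun_prop) (by intro x hx; simp [hx])
  obtain ⟨i4, z4⟩ := dv_int 3 hφ hc hv hu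
  have hcac := cacc hφ hc hv hM
  simp only [hb, mul_zero, integral_zero, zero_add] at hcac
  have hmm : M⁻¹ * M = 1 := inv_mul_cancel₀ hM0.ne'
  have j1 := i1.const_mul ((M⁻¹) ^ 2 / 144)
  have j2 := i2.const_mul (52 * M ^ 2)
  have j3 := i3.const_mul (1 / 4)
  have := integral_mono i3 (i4.add (j1.add (j2.add j3))) (fun x => lap_pt hmm x (hM x))
  rw [integral_add' i4 (j1.add (j2.add j3)), integral_add' j1 (j2.add j3),
    integral_add' j2 j3, integral_const_mul,
    integral_const_mul, integral_const_mul, z4] at this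
  set A := ∫ x, φ x ^ 6 * gsq n (lapE n u) x
  set B := ∫ x, φ x ^ 4 * lapE n u x ^ 2
  set G := ∫ x, φ x ^ 2 * gsq n u x
  have t : (M⁻¹) ^ 2 / 144 * A ≤ 1 / 4 * B := by
    have : (M⁻¹) ^ 2 / 144 * A ≤ (M⁻¹) ^ 2 / 144 * (36 * M ^ 2 * B) := by gcongr
    have e : (M⁻¹) ^ 2 / 144 * (36 * M ^ 2 * B) = (M⁻¹ * M) ^ 2 * (1 / 4 * B) := by ring
    rw [e, hmm] at this
    linarith
  have hB : B ≤ 104 * M ^ 2 * G := by linarith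
  calc A ≤ 36 * M ^ 2 * B := hcac
    _ ≤ 36 * M ^ 2 * (104 * M ^ 2 * G) := by gcongr
    _ = _ := by ring

lemma hess_bound {n : ℕ} {φ u : EuclideanSpace ℝ (Fin n) → ℝ} {M : ℝ} (hM0 : 0 < M)
    (hφ : ContDiff ℝ (⊤ : ℕ∞) φ) (hc : HasCompactSupport φ)
    (h01 : ∀ x, 0 ≤ φ x ∧ φ x ≤ 1)
    (hu : ContDiff ℝ (⊤ : ℕ∞) u) (hM : ∀ x, gsq n φ x ≤ M ^ 2)
    (hb : ∀ x, lapE n (lapE n u) x = 0) :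
    ∫ x, φ x ^ 6 * hessNormSq n u x ≤ 3781 * M ^ 2 * ∫ x, φ x ^ 2 * gsq n u x := by
  have hv := lapE_smooth hu
  have hl := lap_bound hM0 hφ hc hu hM hb
  have cφ := hφ.continuous
  have cv := hv.continuous
  have cg := gsq_cont hv
  have cu := gsq_cont hu
  have cD : ∀ i, Continuous (Dd n i u) := fun i => (Dd_smooth i hu).continuous
  have cDv : ∀ i, Continuous (Dd n i (lapE n u)) := fun i => (Dd_smooth i hv).continuous
  have cH : ∀ i, Continuous (gsq n (Dd n i u)) := fun i => gsq_cont (Dd_smooth i hu)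
  have i1 : ∀ i, Integrable (fun x => φ x ^ 6 * Dd n i (lapE n u) x ^ 2) := fun i =>
    int_of hc (by have := cDv i; fun_prop) (by intro x hx; simp [hx])
  have i2 : ∀ i, Integrable (fun x => φ x ^ 2 * Dd n i u x ^ 2) := fun i =>
    int_of hc (by have := cD i; fun_prop) (by intro x hx; simp [hx])
  have i3 : ∀ i, Integrable (fun x => φ x ^ 6 * Dd n i u x * Dd n i (lapE n u) x) := fun i =>
    int_of hc (by have := cD i; have := cDv i; fun_prop) (by intro x hx; simp [hx])
  have i4 : ∀ i, Integrable (fun x => φ x ^ 4 * Dd n i u x ^ 2) := fun i =>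
    int_of hc (by have := cD i; fun_prop) (by intro x hx; simp [hx])
  have i5 : ∀ i, Integrable (fun x => φ x ^ 6 * gsq n (Dd n i u) x) := fun i =>
    int_of hc (by have := cH i; fun_prop) (by intro x hx; simp [hx])
  have hmm : M⁻¹ * M = 1 := inv_mul_cancel₀ hM0.ne'
  have per : ∀ i, ∫ x, φ x ^ 6 * gsq n (Dd n i u) x ≤
      (M⁻¹) ^ 2 * (∫ x, φ x ^ 6 * Dd n i (lapE n u) x ^ 2)
        + 37 * M ^ 2 * ∫ x, φ x ^ 2 * Dd n i u x ^ 2 := by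
    intro i
    have h := cacc hφ hc (Dd_smooth i hu) hM
    simp only [lapE_Dd i hu] at h
    have hA : ∫ x, φ x ^ 4 * Dd n i u x ^ 2 ≤ ∫ x, φ x ^ 2 * Dd n i u x ^ 2 := by
      refine integral_mono (i4 i) (i2 i) fun x => ?_
      have : φ x ^ 4 ≤ φ x ^ 2 := pow_le_pow_of_le_one (h01 x).1 (h01 x).2 (by norm_num)
      dsimp only
      gcongr
    have hB : -2 * ∫ x, φ x ^ 6 * Dd n i u x * Dd n i (lapE n u) x ≤
        (M⁻¹) ^ 2 * (∫ x, φ x ^ 6 * Dd n i (lapE n u) x ^ 2)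
        + M ^ 2 * ∫ x, φ x ^ 2 * Dd n i u x ^ 2 := by
      rw [← integral_const_mul, ← integral_const_mul, ← integral_const_mul,
        ← integral_add ((i1 i).const_mul _) ((i2 i).const_mul _)]
      refine integral_mono ((i3 i).const_mul _) (((i1 i).const_mul _).add ((i2 i).const_mul _))
        fun x => ?_
      have h62 : φ x ^ 6 ≤ φ x ^ 2 := pow_le_pow_of_le_one (h01 x).1 (h01 x).2 (by norm_num)
      have h1 : M ^ 2 * (φ x ^ 6 * Dd n i u x ^ 2) ≤ M ^ 2 * (φ x ^ 2 * Dd n i u x ^ 2) := by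
        gcongr
      have s := sq_nonneg (M⁻¹ * φ x ^ 3 * Dd n i (lapE n u) x + M * φ x ^ 3 * Dd n i u x)
      have e : (M⁻¹ * φ x ^ 3 * Dd n i (lapE n u) x + M * φ x ^ 3 * Dd n i u x) ^ 2 =
        (M⁻¹) ^ 2 * (φ x ^ 6 * Dd n i (lapE n u) x ^ 2) +
        2 * (φ x ^ 6 * Dd n i u x * Dd n i (lapE n u) x) * (M⁻¹ * M) +
        M ^ 2 * (φ x ^ 6 * Dd n i u x ^ 2) := by ring
      rw [hmm] at e
      rw [e] at s
      dsimp only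
      linarith
    have hA' : 36 * M ^ 2 * ∫ x, φ x ^ 4 * Dd n i u x ^ 2 ≤
      36 * M ^ 2 * ∫ x, φ x ^ 2 * Dd n i u x ^ 2 := by gcongr
    linarith
  have eH : ∫ x, φ x ^ 6 * hessNormSq n u x = ∑ i, ∫ x, φ x ^ 6 * gsq n (Dd n i u) x := by
    rw [← integral_finsetSum _ fun i _ => i5 i]
    simp only [hess_eq, Finset.mul_sum]
  have eV : ∫ x, φ x ^ 6 * gsq n (lapE n u) x = ∑ i, ∫ x, φ x ^ 6 * Dd n i (lapE n u) x ^ 2 := by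
    rw [← integral_finsetSum _ fun i _ => i1 i]
    simp only [gsq, Finset.mul_sum]
  have eU : ∫ x, φ x ^ 2 * gsq n u x = ∑ i, ∫ x, φ x ^ 2 * Dd n i u x ^ 2 := by
    rw [← integral_finsetSum _ fun i _ => i2 i]
    simp only [gsq, Finset.mul_sum]
  have hs := Finset.sum_le_sum (fun i (_ : i ∈ Finset.univ) => per i)
  rw [← eH, Finset.sum_add_distrib, ← Finset.mul_sum, ← Finset.mul_sum, ← eV, ← eU] at hs
  have ht : (M⁻¹) ^ 2 * (∫ x, φ x ^ 6 * gsq n (lapE n u) x) ≤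
      (M⁻¹) ^ 2 * (3744 * M ^ 4 * ∫ x, φ x ^ 2 * gsq n u x) := by gcongr
  have e : (M⁻¹) ^ 2 * (3744 * M ^ 4 * ∫ x, φ x ^ 2 * gsq n u x) =
      (M⁻¹ * M) ^ 2 * (3744 * M ^ 2 * ∫ x, φ x ^ 2 * gsq n u x) := by ring
  rw [e, hmm] at ht
  linarith

lemma exists_cutoff (n : ℕ) (ε : ℝ) (hε : ε ∈ Set.Ioo (0 : ℝ) 1) :
    ∃ C : ℝ, 0 < C ∧ ∀ (p : EuclideanSpace ℝ (Fin n)) (r : ℝ), 0 < r →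
      ∃ φ : EuclideanSpace ℝ (Fin n) → ℝ, ContDiff ℝ (⊤ : ℕ∞) φ ∧ HasCompactSupport φ ∧
        (∀ x, 0 ≤ φ x ∧ φ x ≤ 1) ∧ (∀ x ∈ ball p (ε * r), φ x = 1) ∧
        (∀ x, x ∉ ball p r → φ x = 0) ∧ ∀ x, gsq n φ x ≤ (C / r) ^ 2 := by
  let b : ContDiffBump (0 : EuclideanSpace ℝ (Fin n)) := ⟨ε, 1, hε.1, hε.2⟩
  have hb : ContDiff ℝ (⊤ : ℕ∞) b := b.contDiff
  have hbc : HasCompactSupport (gsq n b) := by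
    refine (b.hasCompactSupport.fderiv (𝕜 := ℝ)).mono ?_
    intro x hx hx'
    apply hx
    simp [gsq, Dd, hx']
  obtain ⟨K, hK⟩ := hbc.exists_bound_of_continuous (gsq_cont hb)
  have hK0 : 0 ≤ K := (norm_nonneg _).trans (hK 0)
  refine ⟨K + 1, by linarith, fun p r hr => ?_⟩
  have hdist : ∀ x, dist (r⁻¹ • (x - p)) 0 = r⁻¹ * dist x p := by
    intro x
    rw [dist_zero_right, norm_smul, dist_eq_norm, Real.norm_of_nonneg (by positivity)]
  have hφ : ContDiff ℝ (⊤ : ℕ∞) (fun x : EuclideanSpace ℝ (Fin n) => b (r⁻¹ • (x - p))) :=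
    hb.comp (by fun_prop)
  have hz : ∀ x, x ∉ ball p r → b (r⁻¹ • (x - p)) = 0 := by
    intro x hx
    apply b.zero_of_le_dist
    rw [hdist]
    change 1 ≤ _
    rw [mem_ball, not_lt] at hx
    rw [inv_mul_eq_div, le_div_iff₀ hr]
    linarith
  refine ⟨fun x => b (r⁻¹ • (x - p)), hφ, ?_, fun x => ⟨b.nonneg, b.le_one⟩, ?_, hz, ?_⟩
  · refine HasCompactSupport.intro (isCompact_closedBall p r) fun x hx => hz x ?_
    exact fun h => hx (ball_subset_closedBall h)
  · intro x hx
    apply b.one_of_mem_closedBall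
    rw [mem_closedBall, hdist]
    change _ ≤ ε
    rw [mem_ball] at hx
    rw [inv_mul_eq_div, div_le_iff₀ hr]
    exact hx.le
  · intro x
    have hD : ∀ i, Dd n i (fun x => b (r⁻¹ • (x - p))) x = r⁻¹ * Dd n i b (r⁻¹ • (x - p)) := by
      intro i
      have h1 : HasFDerivAt (fun x : EuclideanSpace ℝ (Fin n) => r⁻¹ • (x - p))
          (r⁻¹ • ContinuousLinearMap.id ℝ (EuclideanSpace ℝ (Fin n))) x :=
        ((hasFDerivAt_id x).sub_const p).const_smul r⁻¹
      have h2 := (smooth_diff hb (r⁻¹ • (x - p))).hasFDerivAt.comp x h1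
      unfold Dd
      have e : (fun x => b (r⁻¹ • (x - p))) = b ∘ (fun x => r⁻¹ • (x - p)) := rfl
      rw [e, h2.fderiv]
      simp
    have : gsq n (fun x => b (r⁻¹ • (x - p))) x = (r⁻¹) ^ 2 * gsq n b (r⁻¹ • (x - p)) := by
      unfold gsq
      simp only [hD, mul_pow, Finset.mul_sum]
    rw [this, div_eq_mul_inv, mul_pow, mul_comm]
    have hk := (le_abs_self _).trans (hK (r⁻¹ • (x - p)))
    gcongr
    nlinarith

lemma ball_le {n : ℕ} {φ f : EuclideanSpace ℝ (Fin n) → ℝ} (s : Set (EuclideanSpace ℝ (Fin n)))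
    (hs : MeasurableSet s)
    (hφ : Continuous φ) (hc : HasCompactSupport φ)
    (h1 : ∀ x ∈ s, φ x = 1) (hf : Continuous f) (hf0 : ∀ x, 0 ≤ f x) :
    ∫ x in s, f x ≤ ∫ x, φ x ^ 6 * f x := by
  have e : ∫ x in s, f x = ∫ x in s, φ x ^ 6 * f x :=
    setIntegral_congr_fun hs fun x hx => by simp [h1 x hx]
  rw [e]
  refine setIntegral_le_integral (int_of hc (by fun_prop) (by intro x hx; simp [hx])) ?_
  refine Filter.Eventually.of_forall fun x => ?_
  have := hf0 x
  simp only [Pi.zero_apply]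
  positivity

lemma le_ball {n : ℕ} {φ f : EuclideanSpace ℝ (Fin n) → ℝ} (p : EuclideanSpace ℝ (Fin n)) (r : ℝ)
    (hφ : Continuous φ) (hc : HasCompactSupport φ) (h01 : ∀ x, 0 ≤ φ x ∧ φ x ≤ 1)
    (h1 : ∀ x, x ∉ ball p r → φ x = 0) (hf : Continuous f) (hf0 : ∀ x, 0 ≤ f x) :
    ∫ x, φ x ^ 2 * f x ≤ ∫ x in ball p r, f x := by
  rw [← setIntegral_eq_integral_of_forall_compl_eq_zero (s := ball p r)
    (fun x hx => by simp [h1 x hx])]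
  refine setIntegral_mono_on
    (int_of hc (by fun_prop) (by intro x hx; simp [hx])).integrableOn ?_ measurableSet_ball ?_
  · exact (hf.continuousOn.integrableOn_compact (isCompact_closedBall p r)).mono_set
      ball_subset_closedBall
  · intro x _
    exact mul_le_of_le_one_left (hf0 x) (pow_le_one₀ (h01 x).1 (h01 x).2)

/-- **Reverse Poincaré inequality for biharmonic functions** (Lemma 3.4, Euclidean case). -/
theorem reverse_poincare_biharmonic (n : ℕ) (hn : 1 ≤ n) (ε : ℝ)
    (hε : ε ∈ Set.Ioo (0 : ℝ) 1) :
    ∃ c : ℝ, 0 < c ∧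
      ∀ (p : EuclideanSpace ℝ (Fin n)) (r : ℝ), 0 < r →
      ∀ u : EuclideanSpace ℝ (Fin n) → ℝ, ContDiff ℝ (⊤ : ℕ∞) u →
      (∀ x, lapE n (lapE n u) x = 0) →
      r ^ 4 * ((∫ x in Metric.ball p (ε * r), hessNormSq n u x) +
          r ^ 2 * ∫ x in Metric.ball p (ε * r), ‖gradient (lapE n u) x‖ ^ 2) ≤
      c * ((∫ x in Metric.ball p r, (u x) ^ 2) +
          r ^ 2 * ∫ x in Metric.ball p r, ‖gradient u x‖ ^ 2) := by
  obtain ⟨C, hC, hcut⟩ := exists_cutoff n ε hε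
  refine ⟨3781 * C ^ 2 + 3744 * C ^ 4, by positivity, fun p r hr u hu hb => ?_⟩
  obtain ⟨φ, hφ, hc, h01, hone, hzero, hM⟩ := hcut p r hr
  have hM0 : 0 < C / r := by positivity
  have hH := hess_bound hM0 hφ hc h01 hu hM hb
  have hV := lap_bound hM0 hφ hc hu hM hb
  have hG := le_ball p r hφ.continuous hc h01 hzero (gsq_cont hu) (gsq_nonneg n u)
  have cH : Continuous (hessNormSq n u) := by
    have : hessNormSq n u = fun x => ∑ j : Fin n, gsq n (Dd n j u) x := funext (hess_eq n u)
    rw [this]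
    exact continuous_finsetSum _ fun i _ => gsq_cont (Dd_smooth i hu)
  have hH0 : ∀ x, 0 ≤ hessNormSq n u x := fun x => by
    rw [hess_eq]
    exact Finset.sum_nonneg fun _ _ => gsq_nonneg _ _ _
  have bH := ball_le (ball p (ε * r)) measurableSet_ball hφ.continuous hc hone cH hH0
  have bV := ball_le (ball p (ε * r)) measurableSet_ball hφ.continuous hc hone
    (gsq_cont (lapE_smooth hu)) (gsq_nonneg n _)
  simp only [gradient_sq]
  have hU : 0 ≤ ∫ x in ball p r, u x ^ 2 := integral_nonneg fun x => sq_nonneg _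
  set G := ∫ x in ball p r, gsq n u x
  set U := ∫ x in ball p r, u x ^ 2
  have h1 : ∫ x in ball p (ε * r), hessNormSq n u x ≤ 3781 * (C / r) ^ 2 * G :=
    (bH.trans hH).trans (by gcongr)
  have h2 : ∫ x in ball p (ε * r), gsq n (lapE n u) x ≤ 3744 * (C / r) ^ 4 * G :=
    (bV.trans hV).trans (by gcongr)
  calc _ ≤ r ^ 4 * (3781 * (C / r) ^ 2 * G + r ^ 2 * (3744 * (C / r) ^ 4 * G)) := by gcongr
    _ = (3781 * C ^ 2 + 3744 * C ^ 4) * (r ^ 2 * G) := by field_simp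
    _ ≤ _ := by gcongr; linarith
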